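/- For any deep sets of nodes X_1,…,X_k of a tree T with k > 2: (x_1,x_k) ∈ mop(X_1,…,X_k) if and only if there exists a node x_2 such that (x_2,x_k) ∈ mop(X_2,…,X_k) and (x_1,x_2) ∈ mop(X_1, mop(X_2,…,X_k)|_1). -/

import Mathlib

namespace TreeIncl

/-- Rooted, ordered, labeled trees: a label and an ordered list of children. -/
inductive OTree (α : Type) : Type where
  | node : α → List (OTree α) → OTree α

namespace OTree

variable {α β : Type}

/-- The label of the root. -/
def label : OTree α → α
  | node a _ => a

/-- The (ordered) children subtrees of the root. -/
def children : OTree α → List (OTree α)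
  | node _ cs => cs

/-- Nodes are identified with positions: lists of child indices from the root. -/
abbrev Node : Type := List ℕ

/-- The subtree rooted at a given position, if the position is valid. -/
def sub : Node → OTree α → Option (OTree α)
  | [], t => some t
  | i :: p, t =>
    match t.children[i]? with
    | some c => sub p c
    | none => none

/-- The set `V(T)` of (positions of) nodes of a tree. -/
def Pos (t : OTree α) : Set Node := {p | sub p t ≠ none}

/-- The label of the node at position `p`. -/
def labelAt (t : OTree α) (p : Node) : Option α := (sub p t).map label

/-- `l_T`: the number of leaves of a tree. -/
def numLeaves : OTree α → ℕ
  | node _ [] => 1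
  | node a (c :: cs) => numLeaves c + numLeaves (node a cs)

/-- `n_T`: the number of nodes of a tree. -/
def numNodes : OTree α → ℕ
  | node _ [] => 1
  | node a (c :: cs) => numNodes c + numNodes (node a cs)

/-- The number of leaves of the subtree rooted at position `p` (0 if `p` is invalid). -/
def leavesAt (t : OTree α) (p : Node) : ℕ := ((sub p t).map numLeaves).getD 0

/-- `v ⪯ w` : `v` is an ancestor of `w` (positions: prefix). -/
def Anc (v w : Node) : Prop := v <+: w

/-- `v ≺ w` : `v` is a proper ancestor of `w` (positions: strict prefix). -/
def SAnc (v w : Node) : Prop := v <+: w ∧ v ≠ w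

/-- `u ◁ w` : `u` is to the left of `w`
    (equivalently: `pre(u) < pre(w)` and `post(u) < post(w)`). -/
def LeftOf (u w : Node) : Prop :=
  ∃ (q : Node) (i j : ℕ) (u' w' : Node), i < j ∧ u = q ++ i :: u' ∧ w = q ++ j :: w'

/-- `u ⊴ w` : `u ◁ w` or `u ⪯ w` or `w ≺ u`. -/
def LeftOrAbove (u w : Node) : Prop := LeftOf u w ∨ Anc u w ∨ SAnc w u

/-- The nearest common ancestor of two positions: longest common prefix. -/
def nca : Node → Node → Node
  | [], _ => []
  | _, [] => []
  | i :: u, j :: w => if i = j then i :: nca u w else []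

/-- A set of nodes is deep: no node is a proper ancestor of another node in the set. -/
def DeepSet (X : Set Node) : Prop := ∀ x ∈ X, ∀ y ∈ X, ¬ SAnc x y

/-- `Deep(X)`: the elements of `X` having no proper descendant in `X`. -/
def DeepOf (X : Set Node) : Set Node := {x | x ∈ X ∧ ¬ ∃ z ∈ X, SAnc x z}

/-- `Φ(X_1, …, X_k)`: xs is a tuple with `x_i ∈ X_i` and `x_1 ◁ x_2 ◁ ⋯ ◁ x_k`. -/
def Phi (Xs : List (Set Node)) (xs : List Node) : Prop :=
  List.Forall₂ (fun x X => x ∈ X) xs Xs ∧ xs.Chain' LeftOf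

/-- `mop(X_1, …, X_k)`: the set of minimum ordered pairs. -/
def Mop (Xs : List (Set Node)) : Set (Node × Node) :=
  {p | (∃ xs, Phi Xs xs ∧ xs.head? = some p.1 ∧ xs.getLast? = some p.2) ∧
    ¬ ∃ ys y1 yk, Phi Xs ys ∧ ys.head? = some y1 ∧ ys.getLast? = some yk ∧
      ((LeftOf p.1 y1 ∧ LeftOf y1 yk ∧ LeftOrAbove yk p.2) ∨
       (LeftOrAbove p.1 y1 ∧ LeftOf y1 yk ∧ LeftOf yk p.2))}

/-- `MopRight(Y, X)`: for `(y₁,y₂) ∈ Y`, `(y₁,x)` is in the result iff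
    `(y₂,x) ∈ mop(Y|₂, X)`. -/
def MopRight (Y : Set (Node × Node)) (X : Set Node) : Set (Node × Node) :=
  {r | ∃ y2, (r.1, y2) ∈ Y ∧ (y2, r.2) ∈ Mop [Prod.snd '' Y, X]}

/-- `MopLeft(X, Y)`: for `(y₁,y₂) ∈ Y`, `(x,y₂)` is in the result iff
    `(x,y₁) ∈ mop(X, Y|₁)`. -/
def MopLeft (X : Set Node) (Y : Set (Node × Node)) : Set (Node × Node) :=
  {r | ∃ y1, (y1, r.2) ∈ Y ∧ (r.1, y1) ∈ Mop [X, Prod.fst '' Y]}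

/-- One deletion step: delete a node of the tree, making its children children of its
parent (in its place, in order); the root may be deleted when it has exactly one
child. -/
inductive DelStep : OTree α → OTree α → Prop
  | root (a : α) (t : OTree α) : DelStep (node a [t]) t
  | splice (a b : α) (pre cs post : List (OTree α)) :
      DelStep (node a (pre ++ node b cs :: post)) (node a (pre ++ cs ++ post))
  | congr (a : α) (pre post : List (OTree α)) {t t' : OTree α} :
      DelStep t t' → DelStep (node a (pre ++ t :: post)) (node a (pre ++ t' :: post))

/-- `P ⊑ T` : `P` can be obtained from `T` by deleting nodes of `T`. -/
def Included (P T : OTree α) : Prop := Relation.ReflTransGen (fun x y => DelStep x y) T P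

/-- An embedding of `P` in `T`: an injective map of nodes preserving labels,
    proper ancestorship, and the left-of relation. -/
structure IsEmb (P T : OTree α) (f : Node → Node) : Prop where
  mem : ∀ p ∈ Pos P, f p ∈ Pos T
  inj : ∀ p ∈ Pos P, ∀ q ∈ Pos P, f p = f q → p = q
  lab : ∀ p ∈ Pos P, labelAt T (f p) = labelAt P p
  anc : ∀ p ∈ Pos P, ∀ q ∈ Pos P, (SAnc p q ↔ SAnc (f p) (f q))
  ord : ∀ p ∈ Pos P, ∀ q ∈ Pos P, (LeftOf p q ↔ LeftOf (f p) (f q))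

/-- A deep embedding: no other embedding maps the root of `P` strictly deeper. -/
def IsDeepEmb (P T : OTree α) (f : Node → Node) : Prop :=
  IsEmb P T f ∧ ¬ ∃ g, IsEmb P T g ∧ SAnc (f []) (g [])

/-- `emb(P,T)`: the set of deep occurrences of `P` in `T`. -/
def emb (P T : OTree α) : Set Node := {w | ∃ f, IsDeepEmb P T f ∧ f [] = w}

/-- `FlAt T x a q` : `q = fl(x, a)`, the first ancestor of `x` labeled `a` in `T`. -/
def FlAt (t : OTree α) (x : Node) (a : α) (q : Node) : Prop :=
  q <+: x ∧ labelAt t q = some a ∧ ∀ r, SAnc q r → r <+: x → labelAt t r ≠ some a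

/-! ### Heavy leaf path decompositions -/

/-- `hv` is a heavy leaf path decomposition of `P`: for each internal node (position)
`p`, `hv p` is the index of a child with the maximum number of descendant leaves. -/
def IsHeavyDecomp (P : OTree α) (hv : Node → ℕ) : Prop :=
  ∀ p s, sub p P = some s → s.children ≠ [] →
    ∃ c, s.children[hv p]? = some c ∧ ∀ c' ∈ s.children, numLeaves c' ≤ numLeaves c

/-- `ldepth(v)`: the number of light edges on the path from the root to `v`. -/
def ldepth (hv : Node → ℕ) (v : Node) : ℕ :=
  (List.range v.length).countP (fun n => v.getD n 0 != hv (v.take n))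

/-- The light nodes on the path from the root to `v`, ordered by increasing depth
    (the root is light; a nonroot node is light iff it is not the heavy child
    of its parent). -/
def lightPrefixes (hv : Node → ℕ) (v : Node) : List Node :=
  ((List.range (v.length + 1)).map (fun n => v.take n)).filter
    (fun q => q.getLast? != some (hv q.dropLast))

/-- The position of `heavy(parent(q))` for a nonroot position `q`. -/
def heavySibPos (hv : Node → ℕ) (q : Node) : Node :=
  q.dropLast ++ [hv q.dropLast]

/-! ### Clusters -/

/-- Two positions are adjacent in the tree (parent/child). -/
def Adj (u v : Node) : Prop := (∃ i, v = u ++ [i]) ∨ (∃ i, u = v ++ [i])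

/-- `S` is (the vertex set of) a nonempty connected subgraph of `T`. -/
def Conn (T : OTree α) (S : Set Node) : Prop :=
  S.Nonempty ∧ S ⊆ Pos T ∧
    ∀ u ∈ S, ∀ v ∈ S, ∀ w, nca u v <+: w → (w <+: u ∨ w <+: v) → w ∈ S

/-- The boundary nodes of a connected subgraph `S` of `T`: nodes of `S` adjacent to a
node of `T` outside `S`, together with the root of `T` if it lies in `S`. -/
def Boundary (T : OTree α) (S : Set Node) : Set Node :=
  {v ∈ S | (∃ u ∈ Pos T, u ∉ S ∧ Adj v u) ∨ v = []}

/-- The edges of `T` joining two nodes of `S`. -/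
def EdgesIn (T : OTree α) (S : Set Node) : Set (Node × Node) :=
  {e | e.1 ∈ S ∧ e.2 ∈ S ∧ e.2 ∈ Pos T ∧ ∃ i, e.2 = e.1 ++ [i]}

/-- A cluster of `T`: a connected subgraph with at most two boundary nodes. -/
def IsCluster (T : OTree α) (S : Set Node) : Prop :=
  Conn T S ∧ (Boundary T S).encard ≤ 2

/-- A cluster partition of `T`. -/
structure IsClusterPartition (T : OTree α) (CS : List (Set Node)) : Prop where
  cluster : ∀ S ∈ CS, IsCluster T S
  coverV : ∀ p ∈ Pos T, ∃ S ∈ CS, p ∈ S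
  coverE : ∀ e ∈ EdgesIn T (Pos T), ∃ S ∈ CS, e ∈ EdgesIn T S
  disjE : CS.Pairwise (fun S₁ S₂ => EdgesIn T S₁ ∩ EdgesIn T S₂ = ∅)
  edge : ∀ S ∈ CS, (EdgesIn T S).Nonempty

/-- Binary tree: every node has at most two children. -/
def IsBinary (t : OTree α) : Prop := ∀ p s, sub p t = some s → s.children.length ≤ 2

/-- Relabeling of a tree. -/
def omap (f : α → β) : OTree α → OTree β
  | node a cs => node (f a) (cs.attach.map (fun c => omap f c.1))
termination_by t => sizeOf t
decreasing_by
  have := List.sizeOf_lt_of_mem c.2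
  simp only [OTree.node.sizeOf_spec]
  omega


theorem Pos.finite : ∀ t : OTree α, (Pos t).Finite
  | node a cs => by
    have h : Pos (node a cs) ⊆
        {[]} ∪ ⋃ i : Fin cs.length, List.cons i.1 '' Pos cs[i] := by
      rintro (_ | ⟨i, p⟩) hp
      · simp
      · by_cases hi : i < cs.length
        · refine Or.inr (Set.mem_iUnion.2 ⟨⟨i, hi⟩, p, ?_, rfl⟩)
          simpa [Pos, sub, children, hi] using hp
        · simp [Pos, sub, children, hi] at hp
    exact ((Set.finite_singleton _).union
      (Set.finite_iUnion fun i => (Pos.finite cs[i]).image _)).subset h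
termination_by t => sizeOf t
decreasing_by
  have := List.sizeOf_lt_of_mem (List.getElem_mem i.2)
  simp only [OTree.node.sizeOf_spec, Fin.getElem_fin]
  omega

@[simp] theorem not_leftOf_nil_left (w : Node) : ¬ LeftOf [] w := by
  rintro ⟨q, i, j, u', w', -, h, -⟩
  simp at h

@[simp] theorem not_leftOf_nil_right (u : Node) : ¬ LeftOf u [] := by
  rintro ⟨q, i, j, u', w', -, -, h⟩
  simp at h

@[simp] theorem leftOf_cons_cons {i j : ℕ} {u w : Node} :
    LeftOf (i :: u) (j :: w) ↔ i < j ∨ i = j ∧ LeftOf u w := by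
  constructor
  · rintro ⟨_ | ⟨k, q⟩, a, b, u', w', h, h1, h2⟩
    · simp_all
    · simp only [List.cons_append, List.cons.injEq] at h1 h2
      exact Or.inr ⟨h1.1.trans h2.1.symm, q, a, b, u', w', h, h1.2, h2.2⟩
  · rintro (h | ⟨rfl, q, a, b, u', w', h, rfl, rfl⟩)
    · exact ⟨[], i, j, u, w, h, rfl, rfl⟩
    · exact ⟨i :: q, a, b, u', w', h, rfl, rfl⟩

theorem LeftOf.trans {u v w : Node} (h₁ : LeftOf u v) (h₂ : LeftOf v w) : LeftOf u w := by
  induction u generalizing v w with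
  | nil => simp at h₁
  | cons i u ih =>
    rcases v with _ | ⟨j, v⟩
    · simp at h₁
    rcases w with _ | ⟨k, w⟩
    · simp at h₂
    rw [leftOf_cons_cons] at *
    rcases h₁ with h₁ | ⟨rfl, h₁⟩ <;> rcases h₂ with h₂ | ⟨rfl, h₂⟩
    · exact Or.inl (h₁.trans h₂)
    · exact Or.inl h₁
    · exact Or.inl h₂
    · exact Or.inr ⟨rfl, ih h₁ h₂⟩

/-- The left-of relation is contained in the lexicographic order on positions. -/
theorem LeftOf.lt {u w : Node} (h : LeftOf u w) : u < w := by
  induction u generalizing w with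
  | nil => simp at h
  | cons i u ih =>
    rcases w with _ | ⟨j, w⟩
    · simp at h
    rw [leftOf_cons_cons] at h
    rw [List.cons_lt_cons_iff]
    exact h.imp_right fun h => ⟨h.1, ih h.2⟩

theorem not_leftOf_of_prefix {u w : Node} (h : u <+: w) : ¬ LeftOf u w ∧ ¬ LeftOf w u := by
  induction u generalizing w with
  | nil => simp
  | cons i u ih =>
    obtain ⟨v, rfl⟩ := h
    simpa using ih (List.prefix_append u v)

theorem leftOf_or_prefix (u w : Node) : LeftOf u w ∨ LeftOf w u ∨ u <+: w ∨ w <+: u := by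
  induction u generalizing w with
  | nil => simp
  | cons i u ih =>
    rcases w with _ | ⟨j, w⟩
    · simp
    rcases lt_trichotomy i j with h | rfl | h
    · simp [h]
    · simpa using ih w
    · simp [h]

theorem DeepSet.leftOf_trichotomy {X : Set Node} (hX : DeepSet X) {x y : Node} (hx : x ∈ X)
    (hy : y ∈ X) : LeftOf x y ∨ x = y ∨ LeftOf y x := by
  rcases leftOf_or_prefix x y with h | h | h | h
  · exact Or.inl h
  · exact Or.inr (Or.inr h)
  · exact Or.inr (Or.inl (by_contra fun hn => hX x hx y hy ⟨h, hn⟩))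
  · exact Or.inr (Or.inl (by_contra fun hn => hX y hy x hx ⟨h, Ne.symm hn⟩))

theorem DeepSet.leftOrAbove_iff {X : Set Node} (hX : DeepSet X) {x y : Node} (hx : x ∈ X)
    (hy : y ∈ X) : LeftOrAbove x y ↔ LeftOf x y ∨ x = y := by
  constructor
  · rintro (h | h | h)
    · exact Or.inl h
    · exact Or.inr (by_contra fun hn => hX x hx y hy ⟨h, hn⟩)
    · exact (hX y hy x hx h).elim
  · rintro (h | rfl)
    · exact Or.inl h
    · exact Or.inr (Or.inl List.prefix_rfl)

/-- `x` and `y` are the first and the last node of a tuple in `Φ(X_1, …, X_k)`. -/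
def PhiEnds (Xs : List (Set Node)) (x y : Node) : Prop :=
  ∃ xs, Phi Xs xs ∧ xs.head? = some x ∧ xs.getLast? = some y

theorem phiEnds_singleton {X : Set Node} {x y : Node} :
    PhiEnds [X] x y ↔ x ∈ X ∧ x = y := by
  constructor
  · rintro ⟨xs, ⟨h, -⟩, h1, h2⟩
    cases h with
    | cons h h' =>
      cases h'
      simp_all
  · rintro ⟨h, rfl⟩
    exact ⟨[x], ⟨by simpa using h, List.isChain_singleton x⟩, by simp, by simp⟩

theorem phiEnds_cons_cons {X Y : Set Node} {Xs : List (Set Node)} {x y : Node} :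
    PhiEnds (X :: Y :: Xs) x y ↔ x ∈ X ∧ ∃ z, LeftOf x z ∧ PhiEnds (Y :: Xs) z y := by
  constructor
  · rintro ⟨xs, ⟨h, hc⟩, h1, h2⟩
    rcases h with _ | ⟨hx, _ | ⟨hz, h⟩⟩
    rename_i a z zs
    replace hc := List.isChain_cons_cons.1 hc
    obtain rfl : a = x := by simpa using h1
    exact ⟨hx, z, hc.1, z :: zs, ⟨.cons hz h, hc.2⟩, rfl, by simpa using h2⟩
  · rintro ⟨hx, z, hxz, xs, ⟨h, hc⟩, h1, h2⟩
    cases h with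
    | @cons a _ zs _ hz h =>
    obtain rfl : a = z := by simpa using h1
    exact ⟨x :: a :: zs, ⟨.cons hx (.cons hz h), List.isChain_cons_cons.2 ⟨hxz, hc⟩⟩, rfl,
      by simpa using h2⟩

theorem phiEnds_pair {X Y : Set Node} {x y : Node} :
    PhiEnds [X, Y] x y ↔ x ∈ X ∧ y ∈ Y ∧ LeftOf x y := by
  rw [phiEnds_cons_cons]
  simp only [phiEnds_singleton]
  grind

theorem PhiEnds.mem_head {X : Set Node} {Xs : List (Set Node)} {x y : Node}
    (h : PhiEnds (X :: Xs) x y) : x ∈ X := by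
  cases Xs with
  | nil => exact (phiEnds_singleton.1 h).1
  | cons Y Xs => exact (phiEnds_cons_cons.1 h).1

theorem exists_last_of_phiEnds (X Y : Set Node) (Xs : List (Set Node)) :
    ∃ B ∈ X :: Y :: Xs, ∀ x y, PhiEnds (X :: Y :: Xs) x y →
      y ∈ B ∧ LeftOf x y ∧ ∀ z ∈ B, LeftOf y z → PhiEnds (X :: Y :: Xs) x z := by
  induction Xs generalizing X Y with
  | nil =>
    refine ⟨Y, by simp, fun x y h => ?_⟩
    rw [phiEnds_pair] at h
    exact ⟨h.2.1, h.2.2, fun z hz hyz => phiEnds_pair.2 ⟨h.1, hz, h.2.2.trans hyz⟩⟩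
  | cons Z Xs ih =>
    obtain ⟨B, hB, hlast⟩ := ih Y Z
    refine ⟨B, List.mem_cons_of_mem _ hB, fun x y h => ?_⟩
    obtain ⟨hx, w, hxw, hwy⟩ := phiEnds_cons_cons.1 h
    obtain ⟨hy, hlt, hext⟩ := hlast w y hwy
    exact ⟨hy, hxw.trans hlt,
      fun z hz hyz => phiEnds_cons_cons.2 ⟨hx, w, hxw, hext z hz hyz⟩⟩

theorem mem_mop_iff {Xs : List (Set Node)} {x y : Node}
    (hlt : ∀ a b, PhiEnds Xs a b → LeftOf a b) :
    (x, y) ∈ Mop Xs ↔ PhiEnds Xs x y ∧ ∀ a b, PhiEnds Xs a b →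
      ¬ (LeftOf x a ∧ LeftOrAbove b y) ∧ ¬ (LeftOrAbove x a ∧ LeftOf b y) := by
  constructor
  · rintro ⟨h, hmin⟩
    refine ⟨h, fun a b hab => ?_⟩
    have hl := hlt a b hab
    obtain ⟨ys, h1, h2, h3⟩ := hab
    exact ⟨fun h => hmin ⟨ys, a, b, h1, h2, h3, Or.inl ⟨h.1, hl, h.2⟩⟩,
      fun h => hmin ⟨ys, a, b, h1, h2, h3, Or.inr ⟨h.1, hl, h.2⟩⟩⟩
  · rintro ⟨h, hmin⟩
    refine ⟨h, ?_⟩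
    rintro ⟨ys, a, b, h1, h2, h3, h | h⟩
    · exact (hmin a b ⟨ys, h1, h2, h3⟩).1 ⟨h.1, h.2.2⟩
    · exact (hmin a b ⟨ys, h1, h2, h3⟩).2 ⟨h.1, h.2.2⟩

/-- (Lemma 2) `mop` can be computed iteratively from the right:
for deep sets `X_1, …, X_k` with `k > 2`, `(x_1, x_k) ∈ mop(X_1, …, X_k)` iff there
is `x_2` with `(x_2, x_k) ∈ mop(X_2, …, X_k)` and
`(x_1, x_2) ∈ mop(X_1, mop(X_2, …, X_k)|₁)`. -/
theorem mop_iterative_left {α : Type} (T : OTree α)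
    (X1 : Set Node) (Xs : List (Set Node))
    (hlen : 2 ≤ Xs.length)
    (hdeep : ∀ X ∈ X1 :: Xs, DeepSet X)
    (hsub : ∀ X ∈ X1 :: Xs, X ⊆ Pos T)
    (x1 xk : Node) :
    (x1, xk) ∈ Mop (X1 :: Xs) ↔
      ∃ x2 : Node, (x2, xk) ∈ Mop Xs ∧
        (x1, x2) ∈ Mop [X1, Prod.fst '' Mop Xs] := by
  obtain ⟨A, C, Zs, rfl⟩ : ∃ A C Zs, Xs = A :: C :: Zs := by
    match Xs, hlen with
    | A :: C :: Zs, _ => exact ⟨A, C, Zs, rfl⟩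
  obtain ⟨B, hB, hlast⟩ := exists_last_of_phiEnds A C Zs
  have hA : A ∈ X1 :: A :: C :: Zs := by simp
  have hB : B ∈ X1 :: A :: C :: Zs := List.mem_cons_of_mem _ hB
  have hAd := hdeep A hA
  have hBd := hdeep B hB
  have hAf : A.Finite := (Pos.finite T).subset (hsub A hA)
  have hBf : B.Finite := (Pos.finite T).subset (hsub B hB)
  set P := PhiEnds (A :: C :: Zs)
  have hPA : ∀ {x y}, P x y → x ∈ A := fun h => h.mem_head
  have hPB : ∀ {x y}, P x y → y ∈ B := fun h => (hlast _ _ h).1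
  have hPlt : ∀ x y, P x y → LeftOf x y := fun x y h => (hlast _ _ h).2.1
  have hext : ∀ {x y z}, P x y → z ∈ B → LeftOf y z → P x z :=
    fun h hz hyz => (hlast _ _ h).2.2 _ hz hyz
  have hmop : ∀ {x y}, (x, y) ∈ Mop (A :: C :: Zs) ↔ P x y ∧ ∀ a b, P a b →
      ¬ (LeftOf x a ∧ (LeftOf b y ∨ b = y)) ∧ ¬ ((LeftOf x a ∨ x = a) ∧ LeftOf b y) := by
    intro x y
    rw [mem_mop_iff hPlt]
    refine and_congr_right fun hxy => forall₃_congr fun a b hab => ?_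
    rw [hAd.leftOrAbove_iff (hPA hxy) (hPA hab), hBd.leftOrAbove_iff (hPB hab) (hPB hxy)]
  set M := Prod.fst '' Mop (A :: C :: Zs)
  have hMA : ∀ {x}, x ∈ M → x ∈ A := by
    rintro _ ⟨⟨x, y⟩, h, rfl⟩
    exact hPA (hmop.1 h).1
  have hrightmost : ∀ {x y}, P x y → ∃ m, P m y ∧ (LeftOf x m ∨ x = m) ∧
      ∀ a, P a y → ¬ LeftOf m a := by
    intro x y hxy
    obtain ⟨m, hm, hmax⟩ := Set.exists_max_image {a | P a y} id
      (hAf.subset fun a ha => hPA ha) ⟨x, hxy⟩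
    refine ⟨m, hm, ?_, fun a ha hma => (hma.lt.trans_le (hmax a ha)).false⟩
    rcases hAd.leftOf_trichotomy (hPA hxy) (hPA hm) with h | h | h
    · exact Or.inl h
    · exact Or.inr h
    · exact ((h.lt.trans_le (hmax x hxy)).false).elim
  have hleftmost : ∀ {x y}, P x y → ∃ m n, (m, n) ∈ Mop (A :: C :: Zs) ∧
      (LeftOf x m ∨ x = m) ∧ (LeftOf n y ∨ n = y) := by
    intro x y hxy
    obtain ⟨n, ⟨a, han, hxa⟩, hmin⟩ := Set.exists_min_image
      {n | ∃ a, P a n ∧ (LeftOf x a ∨ x = a)} id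
      (hBf.subset fun n ⟨a, ha, _⟩ => hPB ha) ⟨y, x, hxy, Or.inr rfl⟩
    obtain ⟨m, hmn, ham, hmax⟩ := hrightmost han
    have hle : ∀ {u v w : Node}, LeftOf u v ∨ u = v → LeftOf v w ∨ v = w →
        LeftOf u w ∨ u = w := by
      rintro u v w (h₁ | rfl) (h₂ | rfl)
      exacts [Or.inl (h₁.trans h₂), Or.inl h₁, Or.inl h₂, Or.inr rfl]
    have hxm := hle hxa ham
    have hnmin : ∀ c b, P c b → (LeftOf m c ∨ m = c) → ¬ LeftOf b n := fun c b hcb hmc hbn =>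
      (hbn.lt.trans_le (hmin b ⟨c, hcb, hle hxm hmc⟩)).false
    refine ⟨m, n, hmop.2 ⟨hmn, fun c b hcb => ⟨?_, fun h => hnmin c b hcb h.1 h.2⟩⟩, hxm, ?_⟩
    · rintro ⟨hmc, hbn | rfl⟩
      · exact hnmin c b hcb (Or.inl hmc) hbn
      · exact hmax c hcb hmc
    · rcases hBd.leftOf_trichotomy (hPB hmn) (hPB hxy) with h | h | h
      · exact Or.inl h
      · exact Or.inr h
      · exact ((h.lt.trans_le (hmin y ⟨x, hxy, Or.inr rfl⟩)).false).elim
  have hmop' : (x1, xk) ∈ Mop (X1 :: A :: C :: Zs) ↔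
      (x1 ∈ X1 ∧ ∃ z, LeftOf x1 z ∧ P z xk) ∧ ∀ a z b, a ∈ X1 → LeftOf a z → P z b →
        ¬ (LeftOf x1 a ∧ (LeftOf b xk ∨ b = xk)) ∧ ¬ (LeftOrAbove x1 a ∧ LeftOf b xk) := by
    rw [mem_mop_iff fun a b h => ?_]
    · simp only [phiEnds_cons_cons (X := X1)]
      refine and_congr_right fun ⟨_, w, _, hw⟩ => ⟨fun h a z b ha haz hzb => ?_,
        fun h a b ⟨ha, z, haz, hzb⟩ => ?_⟩
      · rw [← hBd.leftOrAbove_iff (hPB hzb) (hPB hw)]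
        exact h a b ⟨ha, z, haz, hzb⟩
      · rw [hBd.leftOrAbove_iff (hPB hzb) (hPB hw)]
        exact h a z b ha haz hzb
    · obtain ⟨_, z, haz, hzb⟩ := phiEnds_cons_cons.1 h
      exact haz.trans (hPlt _ _ hzb)
  have hmop2 : ∀ {x2}, (x1, x2) ∈ Mop [X1, M] ↔ (x1 ∈ X1 ∧ x2 ∈ M ∧ LeftOf x1 x2) ∧
      ∀ a z, a ∈ X1 → z ∈ M → LeftOf a z →
        ¬ (LeftOf x1 a ∧ (LeftOf z x2 ∨ z = x2)) ∧ ¬ (LeftOrAbove x1 a ∧ LeftOf z x2) := by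
    intro x2
    rw [mem_mop_iff fun a b h => (phiEnds_pair.1 h).2.2]
    simp only [phiEnds_pair]
    refine and_congr_right fun ⟨_, hx2, _⟩ => ⟨fun h a z ha hz haz => ?_,
      fun h a z ⟨ha, hz, haz⟩ => ?_⟩
    · rw [← hAd.leftOrAbove_iff (hMA hz) (hMA hx2)]
      exact h a z ⟨ha, hz, haz⟩
    · rw [hAd.leftOrAbove_iff (hMA hz) (hMA hx2)]
      exact h a z ha hz haz
  rw [hmop']
  constructor
  · rintro ⟨⟨hx1, z, hx1z, hzk⟩, hmin⟩
    obtain ⟨x2, hx2, hzx2, hmax⟩ := hrightmost hzk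
    have h12 : LeftOf x1 x2 := hzx2.elim hx1z.trans fun h => h ▸ hx1z
    have hx2k : (x2, xk) ∈ Mop (A :: C :: Zs) := by
      refine hmop.2 ⟨hx2, fun a b hab => ⟨?_, ?_⟩⟩
      · rintro ⟨h2a, hbk | rfl⟩
        · exact hmax a (hext hab (hPB hx2) hbk) h2a
        · exact hmax a hab h2a
      · rintro ⟨h2a, hbk⟩
        have h1a : LeftOf x1 a := h2a.elim h12.trans fun h => h ▸ h12
        exact (hmin x1 a b hx1 h1a hab).2 ⟨Or.inr (Or.inl List.prefix_rfl), hbk⟩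
    refine ⟨x2, hx2k, hmop2.2 ⟨⟨hx1, ⟨_, hx2k, rfl⟩, h12⟩, fun a z ha hz haz => ⟨?_, ?_⟩⟩⟩
    · rintro ⟨h1a, hz2⟩
      have ha2 : LeftOf a x2 := hz2.elim haz.trans fun h => h ▸ haz
      exact (hmin a x2 xk ha ha2 hx2).1 ⟨h1a, Or.inr rfl⟩
    · rintro ⟨h1a, hz2⟩
      obtain ⟨⟨z, b⟩, hzb, rfl⟩ := hz
      obtain ⟨hzb, hzmin⟩ := hmop.1 hzb
      rcases hBd.leftOf_trichotomy (hPB hzb) (hPB hx2) with h | h | h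
      · exact (hmin a z b ha haz hzb).2 ⟨h1a, h⟩
      · exact (hzmin x2 xk hx2).1 ⟨hz2, Or.inr h.symm⟩
      · exact (hzmin x2 xk hx2).1 ⟨hz2, Or.inl h⟩
  · rintro ⟨x2, hx2k, h12⟩
    obtain ⟨⟨hx1, hx2M, h12⟩, hmin1⟩ := hmop2.1 h12
    obtain ⟨hx2, hmin2⟩ := hmop.1 hx2k
    refine ⟨⟨hx1, x2, h12, hx2⟩, fun a z b ha haz hzb => ⟨?_, ?_⟩⟩
    · rintro ⟨h1a, hbk⟩
      rcases hAd.leftOf_trichotomy (hPA hx2) (hPA hzb) with h | rfl | h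
      · exact (hmin2 z b hzb).1 ⟨h, hbk⟩
      · exact (hmin1 a x2 ha hx2M haz).1 ⟨h1a, Or.inr rfl⟩
      · exact (hmin1 a x2 ha hx2M (haz.trans h)).1 ⟨h1a, Or.inr rfl⟩
    · rintro ⟨h1a, hbk⟩
      obtain ⟨m, n, hmn, hzm, hnb⟩ := hleftmost hzb
      have hnk : LeftOf n xk := hnb.elim (fun h => h.trans hbk) fun h => h ▸ hbk
      have ham : LeftOf a m := hzm.elim haz.trans fun h => h ▸ haz
      have hmn' := (hmop.1 hmn).1
      rcases hAd.leftOf_trichotomy (hPA hx2) (hPA hmn') with h | h | h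
      · exact (hmin2 m n hmn').2 ⟨Or.inl h, hnk⟩
      · exact (hmin2 m n hmn').2 ⟨Or.inr h, hnk⟩
      · exact (hmin1 a m ha ⟨_, hmn, rfl⟩ ham).2 ⟨h1a, h⟩

end OTree

end TreeIncl
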